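/- In a finite group G, for every positive integer i that is an element order of G, i divides the sum over all divisors j of i of the number of elements of order j in G. -/

import Mathlib

open Finset Classical in
theorem frob_decomp {G : Type*} [Group G] [Fintype G] (q k : ℕ) (hqk : q.Coprime k) :
    #{x : G | x ^ (q * k) = 1} =
      ∑ y ∈ ({y : G | y ^ k = 1} : Finset G), #{u : G | Commute u y ∧ u ^ q = 1} := by
  obtain ⟨e, he1, he2⟩ := Nat.chineseRemainder hqk 0 1
  obtain ⟨f, hf1, hf2⟩ := Nat.chineseRemainder hqk 1 0
  have hef : e + f ≡ 1 [MOD q * k] :=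
    (Nat.modEq_and_modEq_iff_modEq_mul hqk).1 ⟨by simpa using he1.add hf1, by simpa using he2.add hf2⟩
  have heq : q ∣ e := (Nat.modEq_zero_iff_dvd).1 he1
  have hfk : k ∣ f := (Nat.modEq_zero_iff_dvd).1 hf2
  rw [← Finset.card_sigma]
  refine Finset.card_nbij' (fun x => ⟨x ^ e, x ^ f⟩) (fun z => z.2 * z.1) ?_ ?_ ?_ ?_
  · intro x hx
    simp only [coe_filter, mem_univ, true_and, Set.mem_ofPred_eq] at hx
    simp only [coe_sigma, Set.mem_sigma_iff, coe_filter, mem_univ, true_and, Set.mem_ofPred_eq]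
    refine ⟨?_, (Commute.refl x).pow_pow _ _, ?_⟩
    · obtain ⟨t, rfl⟩ := heq
      rw [← pow_mul, show q * t * k = q * k * t by ring, pow_mul, hx, one_pow]
    · obtain ⟨t, rfl⟩ := hfk
      rw [← pow_mul, show k * t * q = q * k * t by ring, pow_mul, hx, one_pow]
  · rintro ⟨y, u⟩ h
    simp only [coe_sigma, Set.mem_sigma_iff, coe_filter, mem_univ, true_and, Set.mem_ofPred_eq] at h
    obtain ⟨hy, hc, hu⟩ := h
    simp only [coe_filter, mem_univ, true_and, Set.mem_ofPred_eq]
    rw [hc.mul_pow, pow_mul, hu, one_pow, mul_comm q, pow_mul, hy, one_pow, one_mul]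
  · intro x hx
    simp only [coe_filter, mem_univ, true_and, Set.mem_ofPred_eq] at hx
    simp only
    rw [← pow_add, add_comm, pow_eq_pow_of_modEq hef hx, pow_one]
  · rintro ⟨y, u⟩ h
    simp only [coe_sigma, Set.mem_sigma_iff, coe_filter, mem_univ, true_and, Set.mem_ofPred_eq] at h
    obtain ⟨hy, hc, hu⟩ := h
    simp only
    rw [hc.mul_pow, hc.mul_pow, pow_eq_pow_of_modEq he1 hu, pow_eq_pow_of_modEq he2 hy,
      pow_eq_pow_of_modEq hf1 hu, pow_eq_pow_of_modEq hf2 hy]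
    simp

open Finset Classical in
theorem frob_conj {G : Type*} [Group G] [Fintype G] (q : ℕ) (y z : G) (h : IsConj y z) :
    #{u : G | Commute u y ∧ u ^ q = 1} = #{u : G | Commute u z ∧ u ^ q = 1} := by
  obtain ⟨g, rfl⟩ := isConj_iff.1 h
  refine Finset.card_equiv (MulAut.conj g).toEquiv ?_
  intro u
  simp only [mem_filter, mem_univ, true_and, MulEquiv.toEquiv_eq_coe, MulEquiv.coe_toEquiv]
  rw [← map_pow, map_eq_one_iff _ (MulAut.conj g).injective,
    show g * y * g⁻¹ = MulAut.conj g y from rfl]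
  simp only [Commute, SemiconjBy, ← map_mul, (MulAut.conj g).injective.eq_iff]

open Finset Classical in
theorem frob_cent {G : Type*} [Group G] [Fintype G] (q : ℕ) (y : G) :
    #{u : G | Commute u y ∧ u ^ q = 1} =
     #{u : Subgroup.centralizer ({y} : Set G) | u ^ q = 1} := by
  symm
  refine Finset.card_bij (fun u _ => (u : G)) ?_ ?_ ?_
  · intro u hu
    simp only [mem_filter, mem_univ, true_and] at hu ⊢
    refine ⟨?_, by rw [← Subgroup.coe_pow, hu, Subgroup.coe_one]⟩
    have := Subgroup.mem_centralizer_singleton_iff.1 u.2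
    first | exact this | exact this.symm
  · intro a _ b _ h
    exact Subtype.ext h
  · intro u hu
    simp only [mem_filter, mem_univ, true_and] at hu
    refine ⟨⟨u, Subgroup.mem_centralizer_singleton_iff.2 (by first | exact hu.1 | exact hu.1.symm)⟩, ?_, rfl⟩
    simp only [mem_filter, mem_univ, true_and]
    exact Subtype.ext hu.2

open Finset Classical in
theorem frob_sum {G : Type*} [Group G] [Fintype G] (p B : ℕ) (hp : p.Prime)
    (hB : p ^ B ∣ Nat.card G) (s : Finset G) (hs : ∀ y z, IsConj y z → y ∈ s → z ∈ s)
    (f : G → ℕ) (hf : ∀ y z, IsConj y z → f y = f z)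
    (h : ∀ y ∈ s, ∀ b, p ^ b ∣ Nat.card (Subgroup.centralizer ({y} : Set G)) → p ^ b ∣ f y) :
    p ^ B ∣ ∑ y ∈ s, f y := by
  rw [← Finset.sum_fiberwise s (ConjClasses.mk) f]
  refine Finset.dvd_sum fun c _ => ?_
  by_cases hne : (s.filter fun i => ConjClasses.mk i = c).Nonempty
  swap
  · rw [not_nonempty_iff_eq_empty.1 hne]; simp
  obtain ⟨y, hy⟩ := hne
  obtain ⟨hys, rfl⟩ := mem_filter.1 hy
  rw [Finset.sum_const_nat (m := f y)]
  swap
  · intro x hx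
    exact hf _ _ (ConjClasses.mk_eq_mk_iff_isConj.1 (mem_filter.1 hx).2)
  have hcard : #(s.filter fun i => ConjClasses.mk i = ConjClasses.mk y) *
      Nat.card (Subgroup.centralizer ({y} : Set G)) = Nat.card G := by
    rw [Subgroup.nat_card_centralizer_nat_card_stabilizer,
      show Nat.card G = Nat.card (ConjAct G) from rfl,
      ← Subgroup.card_mul_index (MulAction.stabilizer (ConjAct G) y), MulAction.index_stabilizer,
      mul_comm, ConjAct.orbit_eq_carrier_conjClasses, ← Set.ncard_coe_finset]
    congr 2
    ext x
    simp only [coe_filter, Set.mem_ofPred_eq, ConjClasses.mem_carrier_iff_mk_eq, and_iff_right_iff_imp]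
    intro hx
    exact hs _ _ (ConjClasses.mk_eq_mk_iff_isConj.1 hx).symm hys
  obtain ⟨b, m, hm, hbm⟩ := Nat.exists_eq_pow_mul_and_not_dvd
    (n := Nat.card (Subgroup.centralizer ({y} : Set G))) Nat.card_pos.ne' p hp.one_lt.ne'
  have h1 := h y hys b (by rw [hbm]; exact dvd_mul_right _ _)
  rw [← hcard, hbm, ← mul_assoc] at hB
  have h2 := (Nat.Coprime.pow_left B ((hp.coprime_iff_not_dvd).2 hm)).dvd_of_dvd_mul_right hB
  exact h2.trans (mul_dvd_mul_left _ h1)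

open Finset Classical in
theorem frob_full (p : ℕ) (hp : p.Prime) (A m : ℕ) (hm : ¬ p ∣ m) (n : ℕ) :
    ∀ {G : Type*} [Group G] [Fintype G], Nat.card G = n → Nat.card G ∣ p ^ A * m →
     ∀ B, p ^ B ∣ Nat.card G → p ^ B ∣ #{u : G | u ^ (p ^ A) = 1} := by
  induction n using Nat.strong_induction_on with
  | _ n ih =>
  intro G _ _ hn hG B hB
  have hcop : (p ^ A).Coprime m := Nat.Coprime.pow_left _ ((hp.coprime_iff_not_dvd).2 hm)
  have key := frob_decomp (G := G) (p ^ A) m hcop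
  have hall : #{x : G | x ^ (p ^ A * m) = 1} = Nat.card G := by
    rw [Nat.card_eq_fintype_card, ← Finset.card_univ]
    congr 1
    ext x
    simp only [mem_filter, mem_univ, true_and, iff_true]
    exact orderOf_dvd_iff_pow_eq_one.1 ((orderOf_dvd_natCard x).trans hG)
  rw [hall, ← Finset.sum_filter_add_sum_filter_not _ (fun y => y ∈ Subgroup.center G)] at key
  have h2 : p ^ B ∣ ∑ y ∈ ({y : G | y ^ m = 1} : Finset G).filter (fun y => ¬ y ∈ Subgroup.center G),
      #{u : G | Commute u y ∧ u ^ (p ^ A) = 1} := by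
    refine frob_sum p B hp hB _ ?_ _ (frob_conj _) ?_
    · rintro y z hyz hy
      simp only [mem_filter, mem_univ, true_and] at hy ⊢
      obtain ⟨g, rfl⟩ := isConj_iff.1 hyz
      refine ⟨by rw [conj_pow, hy.1]; simp, fun hc => hy.2 ?_⟩
      have := Subgroup.Normal.conj_mem inferInstance _ hc g⁻¹
      simpa [mul_assoc] using this
    · intro y hy b hb
      simp only [mem_filter, mem_univ, true_and] at hy
      rw [frob_cent]
      have hd := Subgroup.card_subgroup_dvd_card (Subgroup.centralizer ({y} : Set G))
      have hlt : Nat.card (Subgroup.centralizer ({y} : Set G)) < n := ?_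
      · have := ih _ hlt rfl (hd.trans hG) b hb
        convert this
      rw [← hn]
      refine lt_of_le_of_ne (Nat.le_of_dvd Nat.card_pos hd) fun he => hy.2 ?_
      have := Subgroup.eq_top_of_card_eq _ he
      rw [Subgroup.mem_center_iff]
      intro g
      have hg : g ∈ Subgroup.centralizer ({y} : Set G) := by rw [this]; trivial
      have := Subgroup.mem_centralizer_singleton_iff.1 hg
      first | exact this | exact this.symm
  have h3 := (Nat.dvd_add_left h2).1 (key ▸ hB)
  rw [Finset.sum_const_nat (m := #{u : G | u ^ (p ^ A) = 1})] at h3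
  swap
  · intro y hy
    have hc := Subgroup.mem_center_iff.1 (mem_filter.1 hy).2
    congr 1
    ext u
    simp only [mem_filter, mem_univ, true_and, and_iff_right_iff_imp]
    intro _
    exact hc u
  refine (Nat.Coprime.pow_left B ((hp.coprime_iff_not_dvd).2 ?_)).dvd_of_dvd_mul_left h3
  intro hdvd
  let K : Subgroup G :=
    { carrier := {y | y ^ m = 1 ∧ y ∈ Subgroup.center G}
      one_mem' := ⟨one_pow _, Subgroup.one_mem _⟩
      mul_mem' := by
        rintro a b ⟨ha, ha'⟩ ⟨hb, hb'⟩
        refine ⟨?_, Subgroup.mul_mem _ ha' hb'⟩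
        have hab : Commute a b := Subgroup.mem_center_iff.1 hb' a
        rw [hab.mul_pow, ha, hb, one_mul]
      inv_mem' := by
        rintro a ⟨ha, ha'⟩
        exact ⟨by rw [inv_pow, ha, inv_one], Subgroup.inv_mem _ ha'⟩ }
  have hK : Nat.card K = #(({y : G | y ^ m = 1} : Finset G).filter (fun y => y ∈ Subgroup.center G)) := by
    rw [Nat.card_eq_fintype_card]
    refine Fintype.card_of_subtype _ ?_
    intro x
    simp only [mem_filter, mem_univ, true_and]
    exact Iff.rfl
  rw [← hK] at hdvd
  haveI : Fact p.Prime := ⟨hp⟩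
  obtain ⟨x, hx⟩ := exists_prime_orderOf_dvd_card' p hdvd
  apply hm
  rw [← hx]
  apply orderOf_dvd_of_pow_eq_one
  exact Subtype.ext x.2.1

open Finset Classical in
theorem frob_top {G : Type*} [Group G] [Fintype G] (p : ℕ) (hp : p.Prime) (A m k : ℕ)
    (hm : ¬ p ∣ m) (hk : ¬ p ∣ k) (hG : Nat.card G ∣ p ^ A * m) (B : ℕ) (hB : p ^ B ∣ Nat.card G) :
    p ^ B ∣ #{x : G | x ^ (p ^ A * k) = 1} := by
  rw [frob_decomp _ _ (Nat.Coprime.pow_left _ ((hp.coprime_iff_not_dvd).2 hk))]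
  refine frob_sum p B hp hB _ ?_ _ (frob_conj _) ?_
  · rintro y z hyz hy
    simp only [mem_filter, mem_univ, true_and] at hy ⊢
    obtain ⟨g, rfl⟩ := isConj_iff.1 hyz
    rw [conj_pow, hy]; simp
  · intro y hy b hb
    rw [frob_cent]
    have := frob_full p hp A m hm _ rfl ((Subgroup.card_subgroup_dvd_card _).trans hG) b hb
    convert this

open Finset Classical in
theorem frob_gen {G : Type*} [Group G] [Fintype G] (g : G) :
    #{x : G | Subgroup.zpowers x = Subgroup.zpowers g} = (orderOf g).totient := by
  have h := IsCyclic.card_orderOf_eq_totient (α := Subgroup.zpowers g) (d := orderOf g)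
    (by rw [Fintype.card_zpowers])
  rw [← h]
  symm
  refine Finset.card_bij (fun u _ => (u : G)) ?_ ?_ ?_
  · intro u hu
    simp only [mem_filter, mem_univ, true_and] at hu ⊢
    refine Subgroup.eq_of_le_of_card_ge (by simpa using u.2) ?_
    rw [Nat.card_zpowers, Nat.card_zpowers, Subgroup.orderOf_coe, hu]
  · intro a _ b _ h
    exact Subtype.ext h
  · intro u hu
    simp only [mem_filter, mem_univ, true_and] at hu
    refine ⟨⟨u, hu ▸ Subgroup.mem_zpowers u⟩, ?_, rfl⟩
    simp only [mem_filter, mem_univ, true_and]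
    rw [← Subgroup.orderOf_coe, ← Nat.card_zpowers, ← Nat.card_zpowers, hu]

open Finset Classical in
theorem frob_diff {G : Type*} [Group G] [Fintype G] (p : ℕ) (hp : p.Prime) (b k : ℕ)
    (hk : ¬ p ∣ k) :
    p ^ b ∣ #{x : G | x ^ (p ^ (b + 1) * k) = 1 ∧ ¬ x ^ (p ^ b * k) = 1} := by
  rw [Finset.card_eq_sum_card_image Subgroup.zpowers]
  refine Finset.dvd_sum fun c hc => ?_
  obtain ⟨g, hg, rfl⟩ := mem_image.1 hc
  simp only [mem_filter, mem_univ, true_and] at hg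
  have : (({x : G | x ^ (p ^ (b + 1) * k) = 1 ∧ ¬ x ^ (p ^ b * k) = 1} : Finset G).filter
      fun a => Subgroup.zpowers a = Subgroup.zpowers g) =
      ({x : G | Subgroup.zpowers x = Subgroup.zpowers g} : Finset G) := by
    ext x
    simp only [mem_filter, mem_univ, true_and, and_iff_right_iff_imp]
    intro hx
    have ho : orderOf x = orderOf g := by rw [← Nat.card_zpowers, ← Nat.card_zpowers, hx]
    rw [← orderOf_dvd_iff_pow_eq_one, ← orderOf_dvd_iff_pow_eq_one, ho,
      orderOf_dvd_iff_pow_eq_one, orderOf_dvd_iff_pow_eq_one]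
    exact hg
  rw [this, frob_gen]
  rw [← orderOf_dvd_iff_pow_eq_one, ← orderOf_dvd_iff_pow_eq_one] at hg
  obtain ⟨e, r, hr, her⟩ := Nat.exists_eq_pow_mul_and_not_dvd (n := orderOf g)
    (orderOf_pos g).ne' p hp.one_lt.ne'
  rw [her] at hg ⊢
  have hrk : r ∣ k := by
    refine Nat.Coprime.dvd_of_dvd_mul_left ?_ ((dvd_mul_left _ _).trans hg.1)
    exact (Nat.Coprime.pow_left _ ((hp.coprime_iff_not_dvd).2 hr)).symm
  have he : b + 1 ≤ e := by
    by_contra hlt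
    exact hg.2 (mul_dvd_mul (pow_dvd_pow _ (by omega)) hrk)
  rw [Nat.totient_mul (Nat.Coprime.pow_left _ ((hp.coprime_iff_not_dvd).2 hr)),
    Nat.totient_prime_pow hp (by omega), mul_assoc]
  exact (pow_dvd_pow _ (by omega)).mul_right _

open Finset Classical in
theorem frob_main {G : Type*} [Group G] [Fintype G] (n : ℕ) (hn : n ∣ Nat.card G) :
    n ∣ #{x : G | x ^ n = 1} := by
  have hG0 : Nat.card G ≠ 0 := Nat.card_pos.ne'
  rw [Nat.dvd_iff_prime_pow_dvd_dvd]
  intro p a hp ha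
  obtain ⟨b, k, hk, hb⟩ := Nat.exists_eq_pow_mul_and_not_dvd (n := n)
    (ne_zero_of_dvd_ne_zero hG0 hn) p hp.one_lt.ne'
  obtain ⟨A, m, hm, hA⟩ := Nat.exists_eq_pow_mul_and_not_dvd (n := Nat.card G)
    hG0 p hp.one_lt.ne'
  have hab : a ≤ b := by
    rw [hb] at ha
    exact (Nat.pow_dvd_pow_iff_le_right hp.one_lt).1
      ((Nat.Coprime.pow_left _ ((hp.coprime_iff_not_dvd).2 hk)).dvd_of_dvd_mul_right ha)
  have hbA : b ≤ A := by
    have h := hn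
    rw [hb, hA] at h
    exact (Nat.pow_dvd_pow_iff_le_right hp.one_lt).1
      ((Nat.Coprime.pow_left _ ((hp.coprime_iff_not_dvd).2 hm)).dvd_of_dvd_mul_right
        ((dvd_mul_right _ _).trans h))
  rw [hb]
  revert hab
  clear hb
  induction hbA using Nat.decreasingInduction with
  | self =>
    intro _
    exact frob_top p hp A m k hm hk hA.dvd a (ha.trans hn)
  | of_succ c hc ih =>
    intro hac
    have h1 := ih (by omega)
    have h2 := (pow_dvd_pow p hac).trans (frob_diff (G := G) p hp c k hk)
    have h3 : #{x : G | x ^ (p ^ (c + 1) * k) = 1} = #{x : G | x ^ (p ^ c * k) = 1} +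
        #{x : G | x ^ (p ^ (c + 1) * k) = 1 ∧ ¬ x ^ (p ^ c * k) = 1} := by
      rw [← Finset.card_filter_add_card_filter_not (s := {x : G | x ^ (p ^ (c + 1) * k) = 1})
        (fun x => x ^ (p ^ c * k) = 1), Finset.filter_filter, Finset.filter_filter]
      congr 2
      ext x
      simp only [mem_filter, mem_univ, true_and, and_iff_right_iff_imp]
      intro hx
      rw [pow_succ, show p ^ c * p * k = p ^ c * k * p by ring, pow_mul, hx, one_pow]
    rw [h3] at h1
    exact (Nat.dvd_add_left h2).1 h1

theorem stmt_9 (G : Type*) [Group G] [Finite G] (i : ℕ) (hi : 0 < i)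
    (hex : ∃ g : G, orderOf g = i) :
    i ∣ ∑ j ∈ i.divisors, Nat.card {x : G | orderOf x = j} := by
  classical
  haveI := Fintype.ofFinite G
  obtain ⟨g, hg⟩ := hex
  have h := frob_main (G := G) i (hg ▸ orderOf_dvd_natCard g)
  have h2 := sum_card_orderOf_eq_card_pow_eq_one (G := G) hi.ne'
  have h3 : ∑ j ∈ i.divisors, Nat.card {x : G | orderOf x = j} =
      ∑ j ∈ i.divisors, (Finset.univ.filter fun x : G => orderOf x = j).card := by
    refine Finset.sum_congr rfl fun j _ => ?_
    rw [Nat.card_eq_fintype_card]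
    exact Fintype.card_of_subtype _ (by simp)
  rw [h3, h2]
  convert h
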